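/- Let Γ be a two-player zero-sum recursive game with countable state space. Suppose that for every n ≥ 1 both players have pure optimal strategies in the n-stage game, and that the family {v_n : n ≥ 1} is totally bounded for the uniform norm. Then Γ has a uniform value v_∞ in pure strategies; moreover, both players can uniformly guarantee v_∞ with pure strategies that depend on the history only through the sequence of states visited (and not on past actions). -/

import Mathlib

open scoped Classical
open Filter

noncomputable section

/-- A two-player zero-sum stochastic game: a state space `X`, action sets `A`, `B`
with a nonempty finite feasible subset at every state, a payoff function with values
in `[-1,1]`, and a finitely supported transition probability function. -/
structure StocGame where
  X : Type
  A : Type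
  B : Type
  actA : X → Finset A
  actB : X → Finset B
  actA_nonempty : ∀ x, (actA x).Nonempty
  actB_nonempty : ∀ x, (actB x).Nonempty
  g : X → A → B → ℝ
  g_bdd : ∀ x a b, |g x a b| ≤ 1
  q : X → A → B → X → ℝ
  q_nonneg : ∀ x a b y, 0 ≤ q x a b y
  q_finsupp : ∀ x a b, (Function.support (q x a b)).Finite
  q_sum : ∀ x a b, (∑' y, q x a b y) = 1

namespace StocGame

variable (G : StocGame)

/-- A behavior strategy of player 1: to every past history (a chronological list of
(state, action of player 1, action of player 2) triples) and every current state, it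
assigns a mixed action supported on the feasible action set. -/
structure Strategy1 where
  play : List (G.X × G.A × G.B) → G.X → G.A → ℝ
  nonneg : ∀ h x a, 0 ≤ play h x a
  supp : ∀ h x a, a ∉ G.actA x → play h x a = 0
  sum_one : ∀ h x, ∑ a ∈ G.actA x, play h x a = 1

/-- A behavior strategy of player 2. -/
structure Strategy2 where
  play : List (G.X × G.A × G.B) → G.X → G.B → ℝ
  nonneg : ∀ h x b, 0 ≤ play h x b
  supp : ∀ h x b, b ∉ G.actB x → play h x b = 0
  sum_one : ∀ h x, ∑ b ∈ G.actB x, play h x b = 1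

variable {G}

/-- The chronological sequence of states visited along a finite history
(past history together with the current state). -/
def stateSeq (hx : List (G.X × G.A × G.B) × G.X) : List G.X :=
  hx.1.map Prod.fst ++ [hx.2]

/-- A strategy of player 1 which depends on the history only through the sequence of
visited states (and not on past actions). -/
def Strategy1.stateDep (σ : Strategy1 G) : Prop :=
  ∀ h h' x, h.map Prod.fst = h'.map Prod.fst → σ.play h x = σ.play h' x

/-- A strategy of player 2 which depends on the history only through the sequence of
visited states (and not on past actions). -/
def Strategy2.stateDep (τ : Strategy2 G) : Prop :=
  ∀ h h' x, h.map Prod.fst = h'.map Prod.fst → τ.play h x = τ.play h' x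

/-- A pure strategy of player 1. -/
def Strategy1.pure (σ : Strategy1 G) : Prop :=
  ∀ h x, ∃ a ∈ G.actA x, σ.play h x a = 1

/-- A pure strategy of player 2. -/
def Strategy2.pure (τ : Strategy2 G) : Prop :=
  ∀ h x, ∃ b ∈ G.actB x, τ.play h x b = 1

variable (G)

/-- Auxiliary function: the probability of a finite history, the past history being
given in reverse chronological order. -/
def histProbAux (x₁ : G.X) (σ : Strategy1 G) (τ : Strategy2 G) :
    List (G.X × G.A × G.B) → G.X → ℝ
  | [], x => if x = x₁ then 1 else 0
  | (y, a, b) :: rest, x =>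
      histProbAux x₁ σ τ rest y * σ.play rest.reverse y a * τ.play rest.reverse y b *
        G.q y a b x

/-- Probability, in the game starting at `x₁` played with `(σ, τ)`, that the play starts
with the (chronological) past history `h` followed by the current state `x`. -/
def histProb (x₁ : G.X) (σ : Strategy1 G) (τ : Strategy2 G)
    (h : List (G.X × G.A × G.B)) (x : G.X) : ℝ :=
  G.histProbAux x₁ σ τ h.reverse x

/-- Expected payoff of stage `t` in the game starting at `x₁` played with `(σ, τ)`. -/
def stagePayoff (x₁ : G.X) (σ : Strategy1 G) (τ : Strategy2 G) (t : ℕ) : ℝ :=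
  ∑' hx : List (G.X × G.A × G.B) × G.X,
    if hx.1.length + 1 = t then
      G.histProb x₁ σ τ hx.1 hx.2 *
        ∑ a ∈ G.actA hx.2, ∑ b ∈ G.actB hx.2,
          σ.play hx.1 hx.2 a * τ.play hx.1 hx.2 b * G.g hx.2 a b
    else 0

/-- Expected average payoff `γ_n(x₁, σ, τ)` over the `n` first stages. -/
def avgPayoff (x₁ : G.X) (σ : Strategy1 G) (τ : Strategy2 G) (n : ℕ) : ℝ :=
  (n : ℝ)⁻¹ * ∑ t ∈ Finset.Icc 1 n, G.stagePayoff x₁ σ τ t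

/-- Expected `λ`-discounted payoff `γ_λ(x₁, σ, τ)`. -/
def discPayoff (x₁ : G.X) (σ : Strategy1 G) (τ : Strategy2 G) (lam : ℝ) : ℝ :=
  ∑' t : ℕ, lam * (1 - lam) ^ t * G.stagePayoff x₁ σ τ (t + 1)

/-- The value `v_n(x₁)` of the `n`-stage game (by the minmax theorem, the game has a
value, which is then equal to this maxmin). -/
def nValue (n : ℕ) (x₁ : G.X) : ℝ :=
  ⨆ σ : Strategy1 G, ⨅ τ : Strategy2 G, G.avgPayoff x₁ σ τ n

/-- The value `v_λ(x₁)` of the `λ`-discounted game. -/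
def lamValue (lam : ℝ) (x₁ : G.X) : ℝ :=
  ⨆ σ : Strategy1 G, ⨅ τ : Strategy2 G, G.discPayoff x₁ σ τ lam

/-- The pointwise limit superior `v(x) = limsup_n v_n(x)` of the `n`-stage values. -/
def limsupV (x : G.X) : ℝ := Filter.limsup (fun n => G.nValue n x) Filter.atTop

/-- The family `{v_n, n ≥ 1}` is totally bounded for the uniform norm: for every
`ε > 0` there is a finite subfamily within uniform distance `ε` of every member. -/
def TotallyBoundedValues : Prop :=
  ∀ ε > (0 : ℝ), ∃ S : Finset ℕ, (∀ m ∈ S, 1 ≤ m) ∧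
    ∀ n, 1 ≤ n → ∃ m ∈ S, ∀ x, |G.nValue n x - G.nValue m x| ≤ ε

/-- Probability that the sequence of the first states of the play is `s`. -/
def statesProb (x₁ : G.X) (σ : Strategy1 G) (τ : Strategy2 G) (s : List G.X) : ℝ :=
  ∑' hx : List (G.X × G.A × G.B) × G.X,
    if stateSeq hx = s then G.histProb x₁ σ τ hx.1 hx.2 else 0

end StocGame

/-- A two-player zero-sum recursive game: a stochastic game whose state space is
partitioned into active states (where the payoff is `0`) and absorbing states (which
are trapping, with a payoff depending only on the state). -/
structure RecGame extends StocGame where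
  absorbing : X → Prop
  g_active : ∀ x a b, ¬ absorbing x → g x a b = 0
  absorbing_q : ∀ x a b, absorbing x → q x a b x = 1
  absorbing_g : ∀ x a b a' b', absorbing x → g x a b = g x a' b'

namespace RecGame

variable (G : RecGame)

/-- The stage payoff as a function of the state only: `0` on active states, and the
absorbing payoff on absorbing states. -/
def stateg (x : G.X) : ℝ :=
  G.g x (G.actA_nonempty x).choose (G.actB_nonempty x).choose

/-- Probability that the play is absorbed within the first `N` stages; since absorbing
states are trapping this is the probability that the state of stage `N` is absorbing,
i.e. `P(ρ ≤ N)` where `ρ` is the absorption time. -/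
def absorbedProb (x₁ : G.X) (σ : G.toStocGame.Strategy1) (τ : G.toStocGame.Strategy2)
    (N : ℕ) : ℝ :=
  ∑' hx : List (G.X × G.A × G.B) × G.X,
    if hx.1.length + 1 = N ∧ G.absorbing hx.2 then
      G.toStocGame.histProb x₁ σ τ hx.1 hx.2 else 0

/-- A uniformly terminating strategy of player 1. -/
def UniformlyTerminating1 (σ : G.toStocGame.Strategy1) : Prop :=
  ∀ ε > (0 : ℝ), ∃ N : ℕ, 1 ≤ N ∧ ∀ x₁, ¬ G.absorbing x₁ →
    ∀ τ, G.absorbedProb x₁ σ τ N ≥ 1 - ε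

end RecGame

namespace StocGame

section Expectation

variable (G : StocGame)

/-- Expectation of `F` at the next state, after the actions `a`, `b` are played at `x`. -/
def expect (x : G.X) (a : G.A) (b : G.B) (F : G.X → ℝ) : ℝ :=
  ∑' y, G.q x a b y * F y

variable {G}

lemma summable_q_mul (x : G.X) (a : G.A) (b : G.B) (F : G.X → ℝ) :
    Summable fun y => G.q x a b y * F y :=
  summable_of_hasFiniteSupport <|
    (G.q_finsupp x a b).subset (Function.support_mul_subset_left _ _)

lemma expect_mono (x : G.X) (a : G.A) (b : G.B) {F F' : G.X → ℝ} (h : ∀ y, F y ≤ F' y) :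
    G.expect x a b F ≤ G.expect x a b F' :=
  (summable_q_mul x a b F).tsum_le_tsum
    (fun y => mul_le_mul_of_nonneg_left (h y) (G.q_nonneg x a b y)) (summable_q_mul x a b F')

lemma expect_affine (x : G.X) (a : G.A) (b : G.B) (F : G.X → ℝ) (c d : ℝ) :
    G.expect x a b (fun y => c * F y + d) = c * G.expect x a b F + d := by
  have h1 : Summable fun y => c * (G.q x a b y * F y) := (summable_q_mul x a b F).mul_left c
  have h2 : Summable fun y => G.q x a b y * d := summable_q_mul x a b fun _ => d
  have h3 : ∀ y, G.q x a b y * (c * F y + d) = c * (G.q x a b y * F y) + G.q x a b y * d :=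
    fun y => by ring
  simp only [expect, h3]
  rw [h1.tsum_add h2, tsum_mul_left, tsum_mul_right, G.q_sum, one_mul]

lemma expect_neg (x : G.X) (a : G.A) (b : G.B) (F : G.X → ℝ) :
    G.expect x a b (fun y => - F y) = - G.expect x a b F := by
  simpa using expect_affine x a b F (-1) 0

lemma expect_const (x : G.X) (a : G.A) (b : G.B) (d : ℝ) :
    G.expect x a b (fun _ => d) = d := by
  simpa using expect_affine x a b (fun _ => 0) 0 d

lemma expect_of_trap {x : G.X} {a : G.A} {b : G.B} (hx : G.q x a b x = 1) (F : G.X → ℝ) :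
    G.expect x a b F = F x := by
  have hs : Summable (G.q x a b) := summable_of_hasFiniteSupport (G.q_finsupp x a b)
  have hz : ∀ y, y ≠ x → G.q x a b y = 0 := fun y hy => by
    have h := hs.sum_le_tsum {x, y} (fun i _ => G.q_nonneg x a b i)
    rw [G.q_sum, Finset.sum_pair hy.symm, hx] at h
    exact le_antisymm (by linarith) (G.q_nonneg x a b y)
  rw [expect, tsum_eq_single x (fun y hy => by rw [hz y hy, zero_mul]), hx, one_mul]

end Expectation

section TotalPayoff

variable {G : StocGame}

/-- Average of `H a b` when the mixed actions prescribed by `σ` and `τ` are played. -/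
def mixed (σ : Strategy1 G) (τ : Strategy2 G) (h : List (G.X × G.A × G.B)) (x : G.X)
    (H : G.A → G.B → ℝ) : ℝ :=
  ∑ a ∈ G.actA x, ∑ b ∈ G.actB x, σ.play h x a * τ.play h x b * H a b

lemma mixed_const (σ : Strategy1 G) (τ : Strategy2 G) (h : List (G.X × G.A × G.B)) (x : G.X)
    (c : ℝ) : mixed σ τ h x (fun _ _ => c) = c := by
  simp only [mixed, ← Finset.sum_mul, ← Finset.mul_sum, τ.sum_one, σ.sum_one, mul_one, one_mul]

lemma mixed_mono {σ : Strategy1 G} {τ : Strategy2 G} {h : List (G.X × G.A × G.B)} {x : G.X}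
    {H H' : G.A → G.B → ℝ}
    (hH : ∀ a ∈ G.actA x, ∀ b ∈ G.actB x, σ.play h x a ≠ 0 → τ.play h x b ≠ 0 → H a b ≤ H' a b) :
    mixed σ τ h x H ≤ mixed σ τ h x H' := by
  refine Finset.sum_le_sum fun a ha => Finset.sum_le_sum fun b hb => ?_
  by_cases h1 : σ.play h x a = 0
  · simp [h1]
  by_cases h2 : τ.play h x b = 0
  · simp [h2]
  exact mul_le_mul_of_nonneg_left (hH a ha b hb h1 h2) (mul_nonneg (σ.nonneg _ _ _) (τ.nonneg _ _ _))

lemma mixed_neg (σ : Strategy1 G) (τ : Strategy2 G) (h : List (G.X × G.A × G.B)) (x : G.X)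
    (H : G.A → G.B → ℝ) : mixed σ τ h x (fun a b => - H a b) = - mixed σ τ h x H := by
  simp [mixed]

lemma mixed_add (σ : Strategy1 G) (τ : Strategy2 G) (h : List (G.X × G.A × G.B)) (x : G.X)
    (H H' : G.A → G.B → ℝ) :
    mixed σ τ h x (fun a b => H a b + H' a b) = mixed σ τ h x H + mixed σ τ h x H' := by
  simp [mixed, mul_add, Finset.sum_add_distrib]

/-- Expected total payoff of the next `n` stages, given the past history and the current
state. -/
def total (σ : Strategy1 G) (τ : Strategy2 G) : ℕ → List (G.X × G.A × G.B) → G.X → ℝ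
  | 0, _, _ => 0
  | n + 1, h, x => mixed σ τ h x fun a b =>
      G.g x a b + G.expect x a b (total σ τ n (h ++ [(x, a, b)]))

/-- Expectation of a function of the history of length `t` and of the current state. -/
def histExp (x₁ : G.X) (σ : Strategy1 G) (τ : Strategy2 G) (t : ℕ)
    (F : List (G.X × G.A × G.B) → G.X → ℝ) : ℝ :=
  ∑' hx : List (G.X × G.A × G.B) × G.X,
    if hx.1.length = t then G.histProb x₁ σ τ hx.1 hx.2 * F hx.1 hx.2 else 0

lemma histProb_concat (x₁ : G.X) (σ : Strategy1 G) (τ : Strategy2 G)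
    (h : List (G.X × G.A × G.B)) (y : G.X) (a : G.A) (b : G.B) (x : G.X) :
    G.histProb x₁ σ τ (h ++ [(y, a, b)]) x =
      G.histProb x₁ σ τ h y * σ.play h y a * τ.play h y b * G.q y a b x := by
  simp [histProb, histProbAux]

/-- Appending a stage to a history. -/
def extend (p : (List (G.X × G.A × G.B) × G.X) × G.A × G.B × G.X) :
    List (G.X × G.A × G.B) × G.X :=
  (p.1.1 ++ [(p.1.2, p.2.1, p.2.2.1)], p.2.2.2)

lemma extend_injective : Function.Injective (extend (G := G)) := by
  rintro ⟨⟨h, y⟩, a, b, x⟩ ⟨⟨h', y'⟩, a', b', x'⟩ hh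
  simp only [extend, Prod.mk.injEq] at hh
  obtain ⟨h1, h2⟩ := hh
  have h3 := List.append_inj' h1 rfl
  simp only [List.cons.injEq, Prod.mk.injEq, and_true] at h3
  obtain ⟨rfl, rfl, rfl, rfl⟩ := h3
  simp [h2]

lemma mem_range_extend {hx : List (G.X × G.A × G.B) × G.X} (h : hx.1.length ≠ 0) :
    hx ∈ Set.range (extend (G := G)) := by
  obtain ⟨l, x⟩ := hx
  rcases List.eq_nil_or_concat l with rfl | ⟨l', ⟨y, a, b⟩, rfl⟩
  · simp at h
  · exact ⟨((l', y), a, b, x), by simp [extend]⟩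

lemma finite_support_histProb (x₁ : G.X) (σ : Strategy1 G) (τ : Strategy2 G) (t : ℕ) :
    {hx : List (G.X × G.A × G.B) × G.X |
      hx.1.length = t ∧ G.histProb x₁ σ τ hx.1 hx.2 ≠ 0}.Finite := by
  induction t with
  | zero =>
    refine (Set.finite_singleton (([] : List (G.X × G.A × G.B)), x₁)).subset ?_
    rintro ⟨l, x⟩ ⟨h1, h2⟩
    obtain rfl := List.length_eq_zero_iff.1 h1
    simp only [histProb, List.reverse_nil, histProbAux, ne_eq, ite_eq_right_iff,
      Classical.not_imp] at h2
    simp [h2.1]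
  | succ t ih =>
    refine (ih.biUnion (t := fun p => ⋃ a ∈ G.actA p.2, ⋃ b ∈ G.actB p.2,
      (fun x => extend (p, a, b, x)) '' Function.support (G.q p.2 a b)) fun p _ =>
        (G.actA p.2).finite_toSet.biUnion fun a _ =>
          (G.actB p.2).finite_toSet.biUnion fun b _ => (G.q_finsupp p.2 a b).image _).subset ?_
    rintro hx ⟨h1, h2⟩
    obtain ⟨⟨⟨h, y⟩, a, b, x⟩, rfl⟩ := mem_range_extend (hx := hx) (by omega)
    simp only [extend, List.length_append, List.length_singleton, histProb_concat] at h1 h2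
    have h3 := right_ne_zero_of_mul h2
    have h4 := right_ne_zero_of_mul (left_ne_zero_of_mul h2)
    have h5 := right_ne_zero_of_mul (left_ne_zero_of_mul (left_ne_zero_of_mul h2))
    have h6 := left_ne_zero_of_mul (left_ne_zero_of_mul (left_ne_zero_of_mul h2))
    simp only [Set.mem_iUnion]
    refine ⟨(h, y), ⟨by simpa using h1, h6⟩, a, ?_, b, ?_, x, h3, rfl⟩
    · by_contra hc
      exact h5 (σ.supp _ _ _ hc)
    · by_contra hc
      exact h4 (τ.supp _ _ _ hc)

lemma finite_support_histExp (x₁ : G.X) (σ : Strategy1 G) (τ : Strategy2 G) (t : ℕ)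
    (F : List (G.X × G.A × G.B) → G.X → ℝ) :
    (Function.support fun hx : List (G.X × G.A × G.B) × G.X =>
      if hx.1.length = t then G.histProb x₁ σ τ hx.1 hx.2 * F hx.1 hx.2 else 0).Finite := by
  refine (finite_support_histProb x₁ σ τ t).subset fun hx h => ?_
  simp only [Function.mem_support, ne_eq, ite_eq_right_iff, Classical.not_imp, mul_eq_zero,
    not_or] at h
  exact ⟨h.1, h.2.1⟩

lemma histExp_add (x₁ : G.X) (σ : Strategy1 G) (τ : Strategy2 G) (t : ℕ)
    (F F' : List (G.X × G.A × G.B) → G.X → ℝ) :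
    histExp x₁ σ τ t (fun h x => F h x + F' h x) = histExp x₁ σ τ t F + histExp x₁ σ τ t F' := by
  rw [histExp, histExp, histExp,
    ← (summable_of_hasFiniteSupport (finite_support_histExp x₁ σ τ t F)).tsum_add
      (summable_of_hasFiniteSupport (finite_support_histExp x₁ σ τ t F'))]
  refine tsum_congr fun hx => ?_
  split_ifs <;> ring

lemma histExp_zero (x₁ : G.X) (σ : Strategy1 G) (τ : Strategy2 G)
    (F : List (G.X × G.A × G.B) → G.X → ℝ) : histExp x₁ σ τ 0 F = F [] x₁ := by
  rw [histExp, tsum_eq_single (([] : List (G.X × G.A × G.B)), x₁)]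
  · simp [histProb, histProbAux]
  · rintro ⟨l, x⟩ hne
    cases l with
    | nil =>
      have : x ≠ x₁ := fun h => hne (by rw [h])
      simp [histProb, histProbAux, this]
    | cons c l => simp

lemma histExp_succ (x₁ : G.X) (σ : Strategy1 G) (τ : Strategy2 G) (t : ℕ)
    (F : List (G.X × G.A × G.B) → G.X → ℝ) :
    histExp x₁ σ τ (t + 1) F = histExp x₁ σ τ t fun h x =>
      mixed σ τ h x fun a b => G.expect x a b (F (h ++ [(x, a, b)])) := by
  have hsub : (Function.support fun hx : List (G.X × G.A × G.B) × G.X =>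
      if hx.1.length = t + 1 then G.histProb x₁ σ τ hx.1 hx.2 * F hx.1 hx.2 else 0) ⊆
      Set.range extend := fun hx h => mem_range_extend fun h0 => by simp [h0] at h
  have hfin := (finite_support_histExp x₁ σ τ (t + 1) F).preimage
    (f := extend) extend_injective.injOn
  rw [histExp, ← extend_injective.tsum_eq hsub, histExp]
  have hs : ∀ {Y Z : Type} (f : Y × Z → ℝ), (Function.support f).Finite →
      ∑' p, f p = ∑' y, ∑' z, f (y, z) := fun f hf =>
    (summable_of_hasFiniteSupport hf).tsum_prod' fun y => summable_of_hasFiniteSupport <|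
      (hf.preimage (f := fun z => (y, z)) (Prod.mk_right_injective y).injOn)
  have hs' : ∀ {Y Z : Type} (f : Y × Z → ℝ) (y : Y), (Function.support f).Finite →
      (Function.support fun z => f (y, z)).Finite := fun f y hf =>
    hf.preimage (f := fun z => (y, z)) (Prod.mk_right_injective y).injOn
  rw [hs _ hfin]
  refine tsum_congr fun p => ?_
  obtain ⟨h, y⟩ := p
  have hfin1 := hs' _ (h, y) hfin
  rw [hs _ hfin1]
  simp only [extend, List.length_append, List.length_singleton, add_left_inj, histProb_concat]
  split_ifs with ht
  · rw [mixed, Finset.mul_sum, tsum_eq_sum (s := G.actA y)]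
    · refine Finset.sum_congr rfl fun a _ => ?_
      have hfin2 := hs' _ a hfin1
      simp only [extend, List.length_append, List.length_singleton, histProb_concat, ht,
        if_true] at hfin2
      rw [hs _ hfin2, tsum_eq_sum (s := G.actB y), Finset.mul_sum]
      · refine Finset.sum_congr rfl fun b _ => ?_
        rw [expect, ← tsum_mul_left, ← tsum_mul_left]
        exact tsum_congr fun x => by ring
      · intro b hb
        simp [τ.supp _ _ _ hb]
    · intro a ha
      simp [σ.supp _ _ _ ha]
  · simp

lemma sum_histExp_eq_total (x₁ : G.X) (σ : Strategy1 G) (τ : Strategy2 G) (n s : ℕ) :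
    ∑ t ∈ Finset.range n, histExp x₁ σ τ (s + t) (fun h x => mixed σ τ h x (G.g x)) =
      histExp x₁ σ τ s (total σ τ n) := by
  induction n generalizing s with
  | zero => simp [histExp, total]
  | succ n ih =>
    have h1 := ih (s + 1)
    rw [histExp_succ] at h1
    rw [Finset.sum_range_succ', add_comm, Finset.sum_congr rfl fun t _ => by
      rw [show s + (t + 1) = s + 1 + t by ring], h1, add_zero, ← histExp_add]
    congr 1
    funext h x
    rw [total, mixed_add]

lemma avgPayoff_eq (x₁ : G.X) (σ : Strategy1 G) (τ : Strategy2 G) (n : ℕ) :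
    G.avgPayoff x₁ σ τ n = (n : ℝ)⁻¹ * total σ τ n [] x₁ := by
  have h1 : ∀ t, G.stagePayoff x₁ σ τ (t + 1) =
      histExp x₁ σ τ (0 + t) fun h x => mixed σ τ h x (G.g x) := fun t => by
    simp only [stagePayoff, histExp, mixed, add_left_inj, zero_add]
  have h2 : Finset.Icc 1 n = Finset.Ico (0 + 1) (n + 1) := by
    ext
    simp only [Finset.mem_Icc, Finset.mem_Ico]
    omega
  rw [avgPayoff, ← histExp_zero x₁ σ τ (total σ τ n), ← sum_histExp_eq_total, h2,
    ← Finset.sum_Ico_add', Finset.range_eq_Ico]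
  simp only [h1]

end TotalPayoff

end StocGame

namespace StocGame

section DynamicProgramming

variable {G : StocGame}

lemma abs_total_le (σ : Strategy1 G) (τ : Strategy2 G) (n : ℕ)
    (h : List (G.X × G.A × G.B)) (x : G.X) : |total σ τ n h x| ≤ n := by
  induction n generalizing h x with
  | zero => simp [total]
  | succ n ih =>
    have hg := fun a b => abs_le.1 (G.g_bdd x a b)
    have hlow : ∀ a b, -(n : ℝ) ≤ G.expect x a b (total σ τ n (h ++ [(x, a, b)])) := fun a b => by
      rw [← expect_const x a b (-(n : ℝ))]
      exact expect_mono x a b fun y => (abs_le.1 (ih _ y)).1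
    have hup : ∀ a b, G.expect x a b (total σ τ n (h ++ [(x, a, b)])) ≤ n := fun a b => by
      rw [← expect_const x a b (n : ℝ)]
      exact expect_mono x a b fun y => (abs_le.1 (ih _ y)).2
    rw [total, abs_le, ← mixed_const σ τ h x (-((n + 1 : ℕ) : ℝ))]
    refine ⟨mixed_mono fun a _ b _ _ _ => ?_, ?_⟩
    · push_cast
      linarith [hlow a b, (hg a b).1]
    · rw [← mixed_const σ τ h x ((n + 1 : ℕ) : ℝ)]
      refine mixed_mono fun a _ b _ _ _ => ?_
      push_cast
      linarith [hup a b, (hg a b).2]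

lemma abs_avgPayoff_le (x₁ : G.X) (σ : Strategy1 G) (τ : Strategy2 G) (n : ℕ) :
    |G.avgPayoff x₁ σ τ n| ≤ 1 := by
  rw [avgPayoff_eq, abs_mul, abs_of_nonneg (by positivity)]
  rcases Nat.eq_zero_or_pos n with rfl | hn
  · simp
  · have h : (0 : ℝ) < n := by exact_mod_cast hn
    rw [inv_mul_le_iff₀ h, mul_one]
    exact abs_total_le σ τ n [] x₁

/-- The continuation of a strategy of player 1 after a first stage `c`. -/
def Strategy1.shift (σ : Strategy1 G) (c : G.X × G.A × G.B) : Strategy1 G where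
  play h x a := σ.play (c :: h) x a
  nonneg _ _ _ := σ.nonneg _ _ _
  supp _ _ _ := σ.supp _ _ _
  sum_one _ _ := σ.sum_one _ _

/-- The strategy of player 2 which plays `b₀` at the first stage whenever it is feasible,
and follows `τ` from the second stage on. -/
def Strategy2.prepend (τ : Strategy2 G) (b₀ : G.B) : Strategy2 G where
  play
    | [], x, b => if b₀ ∈ G.actB x then (if b = b₀ then 1 else 0) else τ.play [] x b
    | _ :: h, x, b => τ.play h x b
  nonneg
    | [], x, b => by
      have := τ.nonneg [] x b
      dsimp only
      split_ifs <;> first | assumption | norm_num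
    | _ :: h, x, b => τ.nonneg h x b
  supp
    | [], x, b, hb => by
      dsimp only
      split_ifs with h1 h2
      · exact absurd h1 (h2 ▸ hb)
      · rfl
      · exact τ.supp _ _ _ hb
    | _ :: h, x, b, hb => τ.supp h x b hb
  sum_one
    | [], x => by
      dsimp only
      split_ifs with h1
      · simp [h1]
      · exact τ.sum_one _ _
    | _ :: h, x => τ.sum_one h x

lemma total_cons (σ : Strategy1 G) (τ : Strategy2 G) (b₀ : G.B) (c : G.X × G.A × G.B) (n : ℕ)
    (h : List (G.X × G.A × G.B)) (x : G.X) :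
    total σ (τ.prepend b₀) n (c :: h) x = total (σ.shift c) τ n h x := by
  induction n generalizing h x with
  | zero => rfl
  | succ n ih =>
    simp only [total, List.cons_append, mixed]
    simp only [Strategy2.prepend, Strategy1.shift]
    refine Finset.sum_congr rfl fun a _ => Finset.sum_congr rfl fun b _ => ?_
    congr 3
    funext y
    exact ih _ _

lemma Strategy1.play_eq_zero {σ : Strategy1 G} {h : List (G.X × G.A × G.B)} {x : G.X}
    {a a' : G.A} (ha : a ∈ G.actA x) (h1 : σ.play h x a = 1) (hne : a' ≠ a) :
    σ.play h x a' = 0 := by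
  by_cases hmem : a' ∈ G.actA x
  · have h2 := σ.sum_one h x
    have h3 := Finset.sum_le_sum_of_subset_of_nonneg (s := {a, a'}) (t := G.actA x)
      (by simp [Finset.insert_subset_iff, ha, hmem]) fun i _ _ => σ.nonneg h x i
    rw [Finset.sum_pair hne.symm, h2, h1] at h3
    exact le_antisymm (by linarith) (σ.nonneg _ _ _)
  · exact σ.supp _ _ _ hmem

/-- Dynamic programming: if `V` is the value of the finitely repeated games and player 1 has
pure optimal strategies, then some first action guarantees the optimality inequality. -/
lemma exists_action_le {V : ℕ → G.X → ℝ}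
    (h1 : ∀ n : ℕ, 1 ≤ n → ∃ σ : Strategy1 G, σ.pure ∧ ∀ x₁ τ, V n x₁ ≤ G.avgPayoff x₁ σ τ n)
    (h2 : ∀ n : ℕ, 1 ≤ n → ∃ τ : Strategy2 G, ∀ x₁ σ, G.avgPayoff x₁ σ τ n ≤ V n x₁)
    {n : ℕ} (hn : 1 ≤ n) (x : G.X) :
    ∃ a ∈ G.actA x, ∀ b ∈ G.actB x,
      (n + 1) * V (n + 1) x ≤ G.g x a b + n * G.expect x a b (V n) := by
  obtain ⟨σ, hσ, hopt⟩ := h1 (n + 1) (by omega)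
  obtain ⟨τ, hτ⟩ := h2 n hn
  obtain ⟨a, ha, ha1⟩ := hσ [] x
  refine ⟨a, ha, fun b hb => ?_⟩
  have h3 := hopt x (τ.prepend b)
  have hn0 : (0 : ℝ) < n := by exact_mod_cast hn
  rw [avgPayoff_eq, le_inv_mul_iff₀ (by positivity)] at h3
  push_cast at h3
  refine h3.trans ?_
  rw [total, ← mixed_const σ (τ.prepend b) [] x (G.g x a b + _)]
  refine mixed_mono fun a' _ b' _ ha' hb' => ?_
  obtain rfl : a' = a := by
    by_contra hne
    exact ha' (Strategy1.play_eq_zero ha ha1 hne)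
  obtain rfl : b' = b := by
    by_contra hne
    simp [Strategy2.prepend, hb, hne] at hb'
  have h4 := expect_affine x a' b' (V n) n 0
  rw [add_zero] at h4
  rw [← h4, add_le_add_iff_left]
  refine expect_mono x a' b' fun y => ?_
  have h5 := hτ y (σ.shift (x, a', b'))
  rw [avgPayoff_eq, inv_mul_le_iff₀ hn0] at h5
  rw [List.nil_append, total_cons, add_zero]
  exact h5

end DynamicProgramming

section Potential

variable {G : StocGame}

/-- The memory state reached after a finite history, when the memory is updated by `nxt`
on the basis of the current state. -/
def memory {M : Type} (m₀ : M) (nxt : M → G.X → M) (h : List (G.X × G.A × G.B)) : M :=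
  (h.map Prod.fst).foldl nxt m₀

/-- The pure strategy of player 1 which plays `act m x` at the state `x` with memory `m`. -/
def automaton {M : Type} (m₀ : M) (nxt : M → G.X → M) (act : M → G.X → G.A)
    (hact : ∀ m x, act m x ∈ G.actA x) : Strategy1 G where
  play h x a := if a = act (memory m₀ nxt h) x then 1 else 0
  nonneg h x a := by split_ifs <;> norm_num
  supp h x a ha := if_neg fun hc : a = _ => ha (hc ▸ hact _ x)
  sum_one h x := by simp [hact]

/-- Payoff guarantee of an automaton along which a potential `Ψ` is a submartingale against
every action of player 2: each stage either pays at least `Ψ - e` or increases `Ψ` by `d` on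
average. -/
lemma automaton_le_total {M : Type} (m₀ : M) (nxt : M → G.X → M) (act : M → G.X → G.A)
    (hact : ∀ m x, act m x ∈ G.actA x) (Ψ : M → G.X → ℝ) {e d K : ℝ} (he : 0 ≤ e) (hd : 0 ≤ d)
    (hK : 0 ≤ K) (hKd : 1 ≤ K * d) (hΨ : ∀ m x, Ψ m x ≤ 1)
    (hstep : ∀ m x, ∀ b ∈ G.actB x,
      (Ψ m x - e ≤ G.g x (act m x) b ∧
        Ψ m x ≤ G.expect x (act m x) b (Ψ (nxt m x))) ∨
      (0 ≤ G.g x (act m x) b ∧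
        Ψ m x + d ≤ G.expect x (act m x) b (Ψ (nxt m x))))
    (τ : Strategy2 G) (n : ℕ) (h : List (G.X × G.A × G.B)) (x : G.X) :
    n * (Ψ (memory m₀ nxt h) x - e) + K * (Ψ (memory m₀ nxt h) x - 1) ≤
      total (automaton m₀ nxt act hact) τ n h x := by
  induction n generalizing h x with
  | zero =>
    have := hΨ (memory m₀ nxt h) x
    simp only [total]
    push_cast
    nlinarith
  | succ n ih =>
    set m := memory m₀ nxt h with hm
    rw [total, ← mixed_const (automaton m₀ nxt act hact) τ h x (_ + _)]
    refine mixed_mono fun a _ b hb ha _ => ?_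
    obtain rfl : a = act m x := by
      by_contra hne
      exact ha (if_neg hne)
    have hmem : memory m₀ nxt (h ++ [(x, act m x, b)]) = nxt m x := by
      simp [memory, hm]
    have h1 : (n + K) * G.expect x (act m x) b (Ψ (nxt m x)) + (-(n * e) - K) ≤
        G.expect x (act m x) b
          (total (automaton m₀ nxt act hact) τ n (h ++ [(x, act m x, b)])) := by
      rw [← expect_affine]
      refine expect_mono _ _ _ fun y => ?_
      have := ih (h ++ [(x, act m x, b)]) y
      rw [hmem] at this
      linarith
    have hΨm := hΨ m x
    have hn0 : (0 : ℝ) ≤ n := Nat.cast_nonneg n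
    push_cast
    rcases hstep m x b hb with ⟨h2, h3⟩ | ⟨h2, h3⟩
    · nlinarith [mul_le_mul_of_nonneg_left h3 (add_nonneg hn0 hK)]
    · nlinarith [mul_le_mul_of_nonneg_left h3 (add_nonneg hn0 hK), mul_nonneg hn0 hd]

end Potential

section Swap

/-- The game in which the roles of the two players are exchanged. -/
@[reducible] def swap (G : StocGame) : StocGame where
  X := G.X
  A := G.B
  B := G.A
  actA := G.actB
  actB := G.actA
  actA_nonempty := G.actB_nonempty
  actB_nonempty := G.actA_nonempty
  g x b a := - G.g x a b
  g_bdd x b a := by simpa using G.g_bdd x a b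
  q x b a := G.q x a b
  q_nonneg x b a := G.q_nonneg x a b
  q_finsupp x b a := G.q_finsupp x a b
  q_sum x b a := G.q_sum x a b

variable {G : StocGame}

/-- Exchange of the actions of the two players in a history. -/
def swapHist {X A B : Type} (h : List (X × A × B)) : List (X × B × A) :=
  h.map fun c => (c.1, c.2.2, c.2.1)

lemma swapHist_swapHist {X A B : Type} (h : List (X × A × B)) : swapHist (swapHist h) = h := by
  simp [swapHist, Function.comp_def]

/-- A strategy of player 2, seen as a strategy of player 1 in the swapped game. -/
def Strategy2.toSwap (τ : Strategy2 G) : Strategy1 G.swap where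
  play h x b := τ.play (swapHist h) x b
  nonneg _ _ _ := τ.nonneg _ _ _
  supp _ _ _ := τ.supp _ _ _
  sum_one _ _ := τ.sum_one _ _

/-- A strategy of player 1, seen as a strategy of player 2 in the swapped game. -/
def Strategy1.toSwap (σ : Strategy1 G) : Strategy2 G.swap where
  play h x a := σ.play (swapHist h) x a
  nonneg _ _ _ := σ.nonneg _ _ _
  supp _ _ _ := σ.supp _ _ _
  sum_one _ _ := σ.sum_one _ _

/-- A strategy of player 1 in the swapped game, seen as a strategy of player 2. -/
def Strategy1.ofSwap (σ : Strategy1 G.swap) : Strategy2 G where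
  play h x b := σ.play (swapHist h) x b
  nonneg _ _ _ := σ.nonneg _ _ _
  supp _ _ _ := σ.supp _ _ _
  sum_one _ _ := σ.sum_one _ _

/-- A strategy of player 2 in the swapped game, seen as a strategy of player 1. -/
def Strategy2.ofSwap (τ : Strategy2 G.swap) : Strategy1 G where
  play h x a := τ.play (swapHist h) x a
  nonneg _ _ _ := τ.nonneg _ _ _
  supp _ _ _ := τ.supp _ _ _
  sum_one _ _ := τ.sum_one _ _

lemma Strategy2.toSwap_ofSwap (τ : Strategy2 G.swap) : τ.ofSwap.toSwap = τ := by
  obtain ⟨p, _, _, _⟩ := τ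
  simp only [Strategy1.toSwap, Strategy2.ofSwap, swapHist_swapHist]

lemma Strategy1.toSwap_ofSwap (σ : Strategy1 G.swap) : σ.ofSwap.toSwap = σ := by
  obtain ⟨p, _, _, _⟩ := σ
  simp only [Strategy2.toSwap, Strategy1.ofSwap, swapHist_swapHist]

lemma total_swap (σ : Strategy1 G) (τ : Strategy2 G) (n : ℕ) (h : List (G.X × G.A × G.B))
    (x : G.X) :
    total τ.toSwap σ.toSwap n (swapHist h) x = - total σ τ n h x := by
  induction n generalizing h x with
  | zero => simp [total]
  | succ n ih =>
    have ih' : ∀ a b y, total τ.toSwap σ.toSwap n (swapHist h ++ [(x, b, a)]) y =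
        - total σ τ n (h ++ [(x, a, b)]) y := fun a b y => by
      rw [← ih]
      simp [swapHist]
    rw [total, total, ← mixed_neg, mixed, mixed, Finset.sum_comm]
    refine Finset.sum_congr rfl fun a _ => Finset.sum_congr rfl fun b _ => ?_
    have h1 : G.swap.expect x b a (total τ.toSwap σ.toSwap n (swapHist h ++ [(x, b, a)])) =
        - G.expect x a b (total σ τ n (h ++ [(x, a, b)])) := by
      rw [← expect_neg]
      exact tsum_congr fun y => congrArg _ (ih' a b y)
    rw [h1]
    simp only [Strategy1.toSwap, Strategy2.toSwap, swapHist_swapHist]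
    ring

lemma avgPayoff_swap (x₁ : G.X) (σ : Strategy1 G) (τ : Strategy2 G) (n : ℕ) :
    G.swap.avgPayoff x₁ τ.toSwap σ.toSwap n = - G.avgPayoff x₁ σ τ n := by
  rw [avgPayoff_eq, avgPayoff_eq, ← mul_neg, ← total_swap]
  rfl

end Swap

end StocGame

/-- `v` is the superior limit of the sequence `V`, uniformly in the sense that the upper bound
holds from a uniform rank on, and that the approximation is achieved at uniformly bounded
ranks. -/
def IsUniformLimsup {X : Type} (V : ℕ → X → ℝ) (v : X → ℝ) : Prop :=
  (∀ δ > (0 : ℝ), ∃ J, ∀ j ≥ J, ∀ x, V j x ≤ v x + δ) ∧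
    ∀ δ > (0 : ℝ), ∀ N, ∃ M, ∀ x, ∃ n, N ≤ n ∧ n ≤ M ∧ v x - δ ≤ V n x

lemma IsUniformLimsup.le_of_forall_le {X : Type} {V : ℕ → X → ℝ} {v : X → ℝ}
    (hv : IsUniformLimsup V v) {x : X} {c : ℝ} (hc : ∀ n, 1 ≤ n → V n x ≤ c) : v x ≤ c := by
  refine le_of_forall_pos_le_add fun δ hδ => ?_
  obtain ⟨M, hM⟩ := hv.2 δ hδ 1
  obtain ⟨n, hn, -, h1⟩ := hM x
  linarith [hc n hn]

lemma IsUniformLimsup.ge_of_forall_ge {X : Type} {V : ℕ → X → ℝ} {v : X → ℝ}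
    (hv : IsUniformLimsup V v) {x : X} {c : ℝ} (hc : ∀ n, 1 ≤ n → c ≤ V n x) : c ≤ v x := by
  refine le_of_forall_pos_le_add fun δ hδ => ?_
  obtain ⟨J, hJ⟩ := hv.1 δ hδ
  linarith [hJ (J + 1) (by omega) x, hc (J + 1) (by omega)]

lemma exists_isUniformLimsup {X : Type} {V : ℕ → X → ℝ} (hV : ∀ n, 1 ≤ n → ∀ x, |V n x| ≤ 1)
    (htb : ∀ ε > (0 : ℝ), ∃ S : Finset ℕ, ∀ n, 1 ≤ n → ∃ m ∈ S, ∀ x, |V n x - V m x| ≤ ε) :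
    ∃ v, IsUniformLimsup V v := by
  set v : X → ℝ := fun x => limsup (fun n => V n x) atTop with hvdef
  have hle : ∀ x, IsBoundedUnder (· ≤ ·) atTop fun n => V n x := fun x =>
    ⟨1, eventually_map.2 <| (eventually_ge_atTop 1).mono fun n hn => (abs_le.1 (hV n hn x)).2⟩
  have hge : ∀ x, IsBoundedUnder (· ≥ ·) atTop fun n => V n x := fun x =>
    ⟨-1, eventually_map.2 <| (eventually_ge_atTop 1).mono fun n hn => (abs_le.1 (hV n hn x)).1⟩
  have hfreq : ∀ x, ∀ δ > (0 : ℝ), ∃ᶠ n in atTop, v x - δ < V n x := fun x δ hδ =>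
    frequently_lt_of_lt_limsup (hge x).isCoboundedUnder_le (by simp only [hvdef]; linarith)
  have hev : ∀ x, ∀ δ > (0 : ℝ), ∀ᶠ n in atTop, V n x < v x + δ := fun x δ hδ =>
    eventually_lt_of_limsup_lt (by simp only [hvdef]; linarith) (hle x)
  have hgood : ∀ δ > (0 : ℝ), ∃ S : Finset ℕ, ∀ᶠ j in atTop, ∃ m ∈ S,
      (∀ x, |V j x - V m x| ≤ δ) ∧ ∃ᶠ n in atTop, ∀ x, |V n x - V m x| ≤ δ := fun δ hδ => by
    obtain ⟨S, hS⟩ := htb δ hδ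
    refine ⟨S, ?_⟩
    have h : ∀ᶠ j in atTop, ∀ m ∈ S, (∀ x, |V j x - V m x| ≤ δ) →
        ∃ᶠ n in atTop, ∀ x, |V n x - V m x| ≤ δ := by
      rw [eventually_all_finset]
      intro m _
      by_cases hf : ∃ᶠ n in atTop, ∀ x, |V n x - V m x| ≤ δ
      · exact Eventually.of_forall fun _ _ => hf
      · exact (not_frequently.1 hf).mono fun j hj hj' => absurd hj' hj
    filter_upwards [h, eventually_ge_atTop 1] with j hj hj1
    obtain ⟨m, hm, hm'⟩ := hS j hj1
    exact ⟨m, hm, hm', hj m hm hm'⟩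
  refine ⟨v, fun δ hδ => ?_, fun δ hδ N => ?_⟩
  · obtain ⟨S, hS⟩ := hgood (δ / 4) (by positivity)
    obtain ⟨J, hJ⟩ := eventually_atTop.1 hS
    refine ⟨J, fun j hj x => ?_⟩
    obtain ⟨m, -, h1, h2⟩ := hJ j hj
    obtain ⟨n, h3, h4⟩ := (h2.and_eventually (hev x (δ / 4) (by positivity))).exists
    linarith [(abs_le.1 (h1 x)).2, (abs_le.1 (h3 x)).1]
  · obtain ⟨S, hS⟩ := hgood (δ / 4) (by positivity)
    have hn : ∀ m, ∃ n, (∃ᶠ n in atTop, ∀ x, |V n x - V m x| ≤ δ / 4) →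
        N ≤ n ∧ ∀ x, |V n x - V m x| ≤ δ / 4 := fun m => by
      by_cases hf : ∃ᶠ n in atTop, ∀ x, |V n x - V m x| ≤ δ / 4
      · obtain ⟨n, h1, h2⟩ := (hf.and_eventually (eventually_ge_atTop N)).exists
        exact ⟨n, fun _ => ⟨h2, h1⟩⟩
      · exact ⟨0, fun h => absurd h hf⟩
    choose r hr using hn
    refine ⟨S.sup r, fun x => ?_⟩
    obtain ⟨j, h1, m, hm, h2, h3⟩ := ((hfreq x (δ / 4) (by positivity)).and_eventually hS).exists
    obtain ⟨h4, h5⟩ := hr m h3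
    refine ⟨r m, h4, Finset.le_sup hm, ?_⟩
    linarith [(abs_le.1 (h2 x)).2, (abs_le.1 (h5 x)).1]

/-- A truncated harmonic sum, equal to `-1` at the rank `J` and vanishing at large ranks. -/
lemma exists_harmonic_ramp {c : ℝ} (hc : 0 < c) (J : ℕ) :
    ∃ (s : ℕ → ℝ) (N : ℕ), (∀ j, s j ≤ 0) ∧ s J = -1 ∧ (∀ j ≥ N, s j = 0) ∧
      ∀ n, 1 ≤ n → s (n + 1) - s n ≤ c / n := by
  set H : ℕ → ℝ := fun j => ∑ i ∈ Finset.range j, 1 / (i : ℝ) with hH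
  have hHt : Tendsto H atTop atTop := by
    rw [← tendsto_add_atTop_iff_nat 1]
    refine Real.tendsto_sum_range_one_div_nat_succ_atTop.congr fun n => ?_
    simp [hH, Finset.sum_range_succ']
  obtain ⟨N, hN⟩ := eventually_atTop.1 (hHt.eventually_ge_atTop (H J + 1 / c))
  refine ⟨fun j => min 0 (-1 + c * (H j - H J)), N, fun j => min_le_left _ _, by simp,
    fun j hj => ?_, fun n hn => ?_⟩
  · have h1 := mul_le_mul_of_nonneg_left (hN j hj) hc.le
    rw [mul_add, mul_one_div_cancel hc.ne'] at h1
    exact min_eq_left (by linarith)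
  · have h1 : H (n + 1) = H n + 1 / n := Finset.sum_range_succ _ _
    have h2 : 0 ≤ c / n := by positivity
    have h3 : c * (H (n + 1) - H J) = c * (H n - H J) + c / n := by
      rw [h1]
      ring
    simp only [h3]
    rcases min_cases (0 : ℝ) (-1 + c * (H n - H J)) with ⟨h, h'⟩ | ⟨h, h'⟩ <;> rw [h]
    · linarith [min_le_left (0 : ℝ) (-1 + (c * (H n - H J) + c / n))]
    · linarith [min_le_right (0 : ℝ) (-1 + (c * (H n - H J) + c / n))]

namespace RecGame

open StocGame

variable {G : RecGame}

lemma total_of_absorbing {x : G.X} (hx : G.absorbing x) (σ : G.toStocGame.Strategy1)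
    (τ : G.toStocGame.Strategy2) (n : ℕ) (h : List (G.X × G.A × G.B)) :
    total σ τ n h x = n * G.stateg x := by
  induction n generalizing h with
  | zero => simp [total]
  | succ n ih =>
    rw [total, ← mixed_const σ τ h x (_ * _)]
    congr 1
    funext a b
    rw [expect_of_trap (G.absorbing_q x a b hx), ih, stateg, G.absorbing_g x a b _ _ hx]
    push_cast
    ring

lemma avgPayoff_of_absorbing {x : G.X} (hx : G.absorbing x) (σ : G.toStocGame.Strategy1)
    (τ : G.toStocGame.Strategy2) {n : ℕ} (hn : 1 ≤ n) :
    G.toStocGame.avgPayoff x σ τ n = G.stateg x := by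
  have : (n : ℝ) ≠ 0 := by positivity
  rw [avgPayoff_eq, total_of_absorbing hx]
  field_simp

/-- `V n` is, for every `n ≥ 1`, the value of the `n`-stage game, and player 1 has pure optimal
strategies. -/
structure HasPureValues (G : RecGame) (V : ℕ → G.X → ℝ) : Prop where
  guarantee1 : ∀ n : ℕ, 1 ≤ n → ∃ σ : G.toStocGame.Strategy1, σ.pure ∧
    ∀ x₁ τ, V n x₁ ≤ G.toStocGame.avgPayoff x₁ σ τ n
  guarantee2 : ∀ n : ℕ, 1 ≤ n → ∃ τ : G.toStocGame.Strategy2,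
    ∀ x₁ σ, G.toStocGame.avgPayoff x₁ σ τ n ≤ V n x₁

namespace HasPureValues

variable {V : ℕ → G.X → ℝ} {v : G.X → ℝ}

lemma abs_le_one (h : G.HasPureValues V) {n : ℕ} (hn : 1 ≤ n) (x : G.X) : |V n x| ≤ 1 := by
  obtain ⟨σ, -, hσ⟩ := h.guarantee1 n hn
  obtain ⟨τ, hτ⟩ := h.guarantee2 n hn
  have := abs_le.1 (abs_avgPayoff_le x σ τ n)
  exact abs_le.2 ⟨by linarith [hτ x σ], by linarith [hσ x τ]⟩

lemma eq_stateg (h : G.HasPureValues V) {n : ℕ} (hn : 1 ≤ n) {x : G.X} (hx : G.absorbing x) :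
    V n x = G.stateg x := by
  obtain ⟨σ, -, hσ⟩ := h.guarantee1 n hn
  obtain ⟨τ, hτ⟩ := h.guarantee2 n hn
  have h1 := hσ x τ
  have h2 := hτ x σ
  rw [avgPayoff_of_absorbing hx σ τ hn] at h1 h2
  exact le_antisymm h1 h2

lemma limsup_eq_stateg (h : G.HasPureValues V) (hv : IsUniformLimsup V v) {x : G.X}
    (hx : G.absorbing x) : v x = G.stateg x :=
  le_antisymm (hv.le_of_forall_le fun _ hn => (h.eq_stateg hn hx).le)
    (hv.ge_of_forall_ge fun _ hn => (h.eq_stateg hn hx).ge)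

lemma exists_action_preserving (h : G.HasPureValues V) (hv : IsUniformLimsup V v) {x : G.X}
    (hx : ¬ G.absorbing x) :
    ∃ a ∈ G.actA x, ∀ b ∈ G.actB x, v x ≤ G.expect x a b v := by
  by_contra! hcon
  have : Nonempty G.B := ⟨(G.actB_nonempty x).choose⟩
  choose! β hβ hlt using hcon
  obtain ⟨a₀, ha₀, hmax⟩ := (G.actA x).exists_max_image (fun a => G.expect x a (β a) v)
    (G.actA_nonempty x)
  set δ := v x - G.expect x a₀ (β a₀) v with hδ
  have hδ0 : 0 < δ := sub_pos.2 (hlt a₀ ha₀)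
  obtain ⟨J, hJ⟩ := hv.1 (δ / 4) (by positivity)
  obtain ⟨R, hR⟩ := exists_nat_gt (2 / δ + 1)
  obtain ⟨M, hM⟩ := hv.2 (δ / 4) (by positivity) (J + R + 2)
  obtain ⟨k, hk, -, hVk⟩ := hM x
  obtain ⟨n, rfl⟩ : ∃ n, k = n + 1 := ⟨k - 1, by omega⟩
  obtain ⟨a, ha, hopt⟩ := exists_action_le h.guarantee1 h.guarantee2 (n := n) (by omega) x
  have h1 := hopt (β a) (hβ a ha)
  rw [G.g_active x _ _ hx, zero_add] at h1
  have h2 : G.expect x a (β a) (V n) ≤ v x - δ + δ / 4 := by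
    have h3 : G.expect x a (β a) (V n) ≤ 1 * G.expect x a (β a) v + δ / 4 := by
      rw [← expect_affine]
      exact expect_mono _ _ _ fun y => by linarith [hJ n (by omega) y]
    linarith [hmax a ha]
  have hv1 : -1 ≤ v x := hv.ge_of_forall_ge fun n hn => (abs_le.1 (h.abs_le_one hn x)).1
  have hn : 2 / δ + 1 < n := hR.trans (by exact_mod_cast (by omega : R < n))
  have h4 : 2 + δ < n * δ := by
    have := mul_lt_mul_of_pos_right hn hδ0
    rwa [add_mul, div_mul_cancel₀ _ hδ0.ne', one_mul] at this
  have hn0 : (0 : ℝ) ≤ n := Nat.cast_nonneg n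
  nlinarith [mul_le_mul_of_nonneg_left h2 hn0,
    mul_le_mul_of_nonneg_left hVk (by positivity : (0 : ℝ) ≤ n + 1)]

/-- Player 1 uniformly guarantees the superior limit of the values with pure strategies
depending only on the states visited. -/
lemma uniformly_guarantees (h : G.HasPureValues V) (hv : IsUniformLimsup V v) {ε : ℝ}
    (hε : 0 < ε) :
    ∃ σ : G.toStocGame.Strategy1, σ.pure ∧ σ.stateDep ∧ ∃ N₀ : ℕ, 1 ≤ N₀ ∧
      ∀ x₁, ∀ n ≥ N₀, ∀ τ, v x₁ - ε ≤ G.toStocGame.avgPayoff x₁ σ τ n := by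
  obtain ⟨e, he0, he1, heε⟩ : ∃ e : ℝ, 0 < e ∧ e ≤ 1 ∧ 3 * e ≤ ε :=
    ⟨min 1 (ε / 3), by positivity, min_le_left _ _, by linarith [min_le_right 1 (ε / 3)]⟩
  have hV1 : ∀ n, 1 ≤ n → ∀ x, V n x ≤ 1 := fun n hn x => (abs_le.1 (h.abs_le_one hn x)).2
  have hv1 : ∀ x, v x ≤ 1 := fun x => hv.le_of_forall_le fun n hn => hV1 n hn x
  have hv2 : ∀ x, -1 ≤ v x := fun x =>
    hv.ge_of_forall_ge fun n hn => (abs_le.1 (h.abs_le_one hn x)).1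
  obtain ⟨J₁, hJ₁⟩ := hv.1 (e ^ 2 / 16) (by positivity)
  obtain ⟨J, hJ1, hJ⟩ : ∃ J, 1 ≤ J ∧ ∀ j ≥ J, ∀ x, V j x ≤ v x + e ^ 2 / 16 :=
    ⟨J₁ + 1, by omega, fun j hj => hJ₁ j (by omega)⟩
  obtain ⟨s, N, hs0, hsJ, hsN, hs⟩ := exists_harmonic_ramp (by positivity : 0 < e / 8) J
  obtain ⟨M, hM0, hM⟩ : ∃ M : ℕ, (0 : ℝ) < M ∧
      ∀ x, ∃ n, N + J + 1 ≤ n ∧ n ≤ M ∧ v x - e ^ 2 / 16 ≤ V n x := by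
    obtain ⟨M, hM⟩ := hv.2 (e ^ 2 / 16) (by positivity) (N + J + 1)
    refine ⟨M + 1, by positivity, fun x => ?_⟩
    obtain ⟨n, h1, h2, h3⟩ := hM x
    exact ⟨n, h1, by omega, h3⟩
  choose r hrN hrM hrV using hM
  have hact : ∀ n x, ∃ a ∈ G.actA x, 1 ≤ n → ∀ b ∈ G.actB x,
      (n + 1) * V (n + 1) x ≤ G.g x a b + n * G.expect x a b (V n) := fun n x => by
    by_cases hn : 1 ≤ n
    · obtain ⟨a, ha, h1⟩ := exists_action_le h.guarantee1 h.guarantee2 hn x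
      exact ⟨a, ha, fun _ => h1⟩
    · obtain ⟨a, ha⟩ := G.actA_nonempty x
      exact ⟨a, ha, fun h1 => absurd h1 hn⟩
  choose α hα hαV using hact
  have hpres : ∀ x, ∃ a ∈ G.actA x, ¬ G.absorbing x → ∀ b ∈ G.actB x,
      v x ≤ G.expect x a b v := fun x => by
    by_cases hx : G.absorbing x
    · obtain ⟨a, ha⟩ := G.actA_nonempty x
      exact ⟨a, ha, fun h1 => absurd hx h1⟩
    · obtain ⟨a, ha, h1⟩ := h.exists_action_preserving hv hx
      exact ⟨a, ha, fun _ => h1⟩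
  choose π hπ hπv using hpres
  -- `mode k x` is the horizon of the finite game which player 1 plays optimally, or `0`
  set mode : ℕ → G.X → ℕ := fun k x =>
    if J < k ∧ k ≤ M ∧ e / 4 ≤ V k x then k else if e < v x then r x else 0 with hmode
  set act : ℕ → G.X → G.A := fun k x => if mode k x = 0 then π x else α (mode k x - 1) x
    with hactdef
  set nxt : ℕ → G.X → ℕ := fun k x => mode k x - 1 with hnxt
  set η : ℝ := e / 2 - 3 * e ^ 2 / 16 with hη
  set Φ : ℕ → G.X → ℝ := fun j x => (1 + e / 2) * V j x + (s j - e / 2) with hΦ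
  set Ψ : ℕ → G.X → ℝ := fun k x =>
    if G.absorbing x then v x else if mode k x = 0 then v x - η else Φ (mode k x) x with hΨ
  have hactmem : ∀ k x, act k x ∈ G.actA x := fun k x => by
    simp only [hactdef]
    split_ifs
    · exact hπ x
    · exact hα _ x
  have he2 : e ^ 2 ≤ e := by nlinarith
  have he20 : 0 < e ^ 2 := by positivity
  have hη0 : 0 ≤ η := by linarith
  have hηe : η ≤ e := by linarith
  have hmode_cases : ∀ k x, mode k x = 0 ∧ v x ≤ e ∨
      (J < mode k x ∧ mode k x ≤ M ∧ e / 4 ≤ V (mode k x) x) := fun k x => by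
    simp only [hmode]
    split_ifs with h1 h2
    · exact Or.inr h1
    · refine Or.inr ⟨by have := hrN x; omega, hrM x, ?_⟩
      linarith [hrV x]
    · exact Or.inl ⟨rfl, not_lt.1 h2⟩
  have hΦ1 : ∀ j, 1 ≤ j → ∀ x, Φ j x ≤ 1 := fun j hj x => by
    have h1 := hV1 j hj x
    have h2 := hs0 j
    simp only [hΦ]
    nlinarith
  have hΨ1 : ∀ k x, Ψ k x ≤ 1 := fun k x => by
    simp only [hΨ]
    split_ifs with h1 h2
    · exact hv1 x
    · linarith [hv1 x]
    · exact hΦ1 _ (Nat.one_le_iff_ne_zero.2 h2) x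
  have hend : ∀ k x, ¬ (J < k ∧ k ≤ M ∧ e / 4 ≤ V k x) → v x - η ≤ Ψ k x := fun k x hk => by
    simp only [hΨ, hmode, if_neg hk]
    split_ifs with h1 h2 h3 h3
    · linarith
    · exact le_rfl
    · have h4 := hrV x
      have h5 : s (r x) = 0 := hsN _ (by have := hrN x; omega)
      simp only [hΦ, h5]
      nlinarith
    · exact le_rfl
    · exact absurd rfl h3
  have hcont : ∀ k, J ≤ k → k ≤ M → ∀ x, Φ k x ≤ Ψ k x := fun k hk hkM x => by
    have hs0k := hs0 k
    by_cases hx : G.absorbing x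
    · have h1 : V k x = v x := by
        rw [h.eq_stateg (hJ1.trans hk) hx, h.limsup_eq_stateg hv hx]
      have h2 := hv1 x
      simp only [hΨ, if_pos hx, hΦ, h1]
      nlinarith
    by_cases hc : J < k ∧ k ≤ M ∧ e / 4 ≤ V k x
    · simp only [hΨ, if_neg hx, hmode, if_pos hc]
      rw [if_neg (by omega)]
    · refine le_trans ?_ (hend k x hc)
      have h1 := hJ k hk x
      have h2 := hV1 k (hJ1.trans hk) x
      simp only [hΦ, hη]
      rcases hk.eq_or_lt with rfl | hlt
      · rw [hsJ]
        nlinarith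
      · have h3 : V k x < e / 4 := by
          by_contra h4
          exact hc ⟨hlt, hkM, not_lt.1 h4⟩
        nlinarith
  set d : ℝ := e / (8 * M) with hd
  have hd0 : 0 < d := by positivity
  have hstep : ∀ k x, ∀ b ∈ G.actB x,
      (Ψ k x - e ≤ G.g x (act k x) b ∧
        Ψ k x ≤ G.expect x (act k x) b (Ψ (nxt k x))) ∨
      (0 ≤ G.g x (act k x) b ∧
        Ψ k x + d ≤ G.expect x (act k x) b (Ψ (nxt k x))) := fun k x b hb => by
    by_cases hx : G.absorbing x
    · left
      rw [expect_of_trap (G.absorbing_q x _ b hx)]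
      simp only [hΨ, if_pos hx]
      rw [h.limsup_eq_stateg hv hx, stateg, G.absorbing_g x (act k x) b _ _ hx]
      exact ⟨by linarith, le_rfl⟩
    rw [G.g_active x _ b hx]
    rcases hmode_cases k x with ⟨h0, hve⟩ | ⟨hmJ, hmM, hmV⟩
    · left
      have h1 : nxt k x = 0 := by simp only [hnxt, h0]
      have h2 : act k x = π x := by simp only [hactdef, if_pos h0]
      have h3 : Ψ k x = v x - η := by simp only [hΨ, if_neg hx, if_pos h0]
      rw [h1, h2, h3]
      refine ⟨by linarith, ?_⟩
      have h4 : 1 * G.expect x (π x) b v + -η ≤ G.expect x (π x) b (Ψ 0) := by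
        rw [← expect_affine]
        refine expect_mono _ _ _ fun y => ?_
        linarith [hend 0 y (by omega)]
      linarith [hπv x hx b hb]
    · right
      refine ⟨le_rfl, ?_⟩
      obtain ⟨n, hn⟩ : ∃ n, mode k x = n + 1 := ⟨mode k x - 1, by omega⟩
      have h1 : nxt k x = n := by simp only [hnxt, hn, Nat.add_sub_cancel]
      have h2 : act k x = α n x := by
        simp only [hactdef, hn, Nat.add_sub_cancel, Nat.succ_ne_zero, if_false]
      have h3 : Ψ k x = Φ (n + 1) x := by
        simp only [hΨ, if_neg hx, hn, Nat.succ_ne_zero, if_false]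
      rw [hn] at hmJ hmM hmV
      have hn1 : 1 ≤ n := by omega
      have hn0 : (0 : ℝ) < n := by exact_mod_cast hn1
      rw [h1, h2, h3]
      have h4 := hαV n x hn1 b hb
      rw [G.g_active x _ b hx, zero_add] at h4
      have h5 : (1 + e / 2) * G.expect x (α n x) b (V n) + (s n - e / 2) ≤
          G.expect x (α n x) b (Ψ n) := by
        rw [← expect_affine]
        exact expect_mono _ _ _ fun y => hcont n (by omega) (by omega) y
      refine le_trans ?_ h5
      set u : ℝ := e / 8 / n with hu
      have hu0 : 0 < u := by positivity
      have hnu : n * u = e / 8 := mul_div_cancel₀ _ hn0.ne'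
      have hdu : d ≤ u := by
        rw [hd, hu, div_div]
        have : (n : ℝ) ≤ M := by exact_mod_cast (by omega : n ≤ M)
        gcongr
      have hsn : s (n + 1) - s n ≤ u := hs n hn1
      have h6 : V (n + 1) x + 2 * u ≤ G.expect x (α n x) b (V n) := by
        refine le_of_mul_le_mul_left ?_ hn0
        linarith
      simp only [hΦ]
      nlinarith
  set K : ℝ := 1 / d with hK
  have hK0 : 0 < K := by positivity
  obtain ⟨N₀, hN₀⟩ := exists_nat_gt (3 * K / e)
  refine ⟨automaton 0 nxt act hactmem, fun l x => ⟨_, hactmem _ x, if_pos rfl⟩, fun l l' x hl => ?_,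
    N₀ + 1, by omega, fun x₁ n hn τ => ?_⟩
  · have h1 : memory 0 nxt l = memory 0 nxt l' := by simp only [memory, hl]
    unfold automaton
    dsimp only
    rw [h1]
  · have h1 := automaton_le_total 0 nxt act hactmem Ψ he0.le hd0.le hK0.le
      (one_div_mul_cancel hd0.ne').ge hΨ1 hstep τ n [] x₁
    have h2 : v x₁ - η ≤ Ψ 0 x₁ := hend 0 x₁ (by omega)
    have hn0 : (0 : ℝ) < n := by exact_mod_cast (by omega : 0 < n)
    have h3 : 3 * K < n * e := by
      rw [← div_lt_iff₀ he0]
      exact hN₀.trans (by exact_mod_cast hn)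
    rw [avgPayoff_eq, le_inv_mul_iff₀ hn0]
    refine le_trans ?_ h1
    simp only [memory, List.map_nil, List.foldl_nil]
    have h4 := hv2 x₁
    nlinarith [mul_le_mul_of_nonneg_left h2 hn0.le, mul_le_mul_of_nonneg_left h2 hK0.le,
      mul_le_mul_of_nonneg_left h4 hK0.le, mul_le_mul_of_nonneg_left hηe hn0.le,
      mul_le_mul_of_nonneg_left heε hn0.le, mul_le_mul_of_nonneg_left (hηe.trans he1) hK0.le]

end HasPureValues

/-- The recursive game in which the roles of the two players are exchanged. -/
@[reducible] def swap (G : RecGame) : RecGame where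
  toStocGame := G.toStocGame.swap
  absorbing := G.absorbing
  g_active x b a hx := by simpa using G.g_active x a b hx
  absorbing_q x b a hx := G.absorbing_q x a b hx
  absorbing_g x b a b' a' hx := congrArg Neg.neg (G.absorbing_g x a b a' b' hx)

end RecGame

/-- Let `Γ` be a two-player zero-sum recursive game with countable
state space. If for every `n ≥ 1` both players have pure optimal strategies in the
`n`-stage game and the family `{v_n : n ≥ 1}` is totally bounded for the uniform norm,
then `Γ` has a uniform value `v_∞` in pure strategies; moreover both players can
uniformly guarantee `v_∞` with pure strategies depending on the history only through
the sequence of states visited. -/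
theorem recursive_game_uniform_value_pure
    (G : RecGame) (hcount : Countable G.X)
    (hpure1 : ∀ n : ℕ, 1 ≤ n → ∃ σ : G.toStocGame.Strategy1, σ.pure ∧
      ∀ x₁, ∀ τ : G.toStocGame.Strategy2,
        G.toStocGame.avgPayoff x₁ σ τ n ≥ G.toStocGame.nValue n x₁)
    (hpure2 : ∀ n : ℕ, 1 ≤ n → ∃ τ : G.toStocGame.Strategy2, τ.pure ∧
      ∀ x₁, ∀ σ : G.toStocGame.Strategy1,
        G.toStocGame.avgPayoff x₁ σ τ n ≤ G.toStocGame.nValue n x₁)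
    (htb : G.toStocGame.TotallyBoundedValues) :
    ∃ vinf : G.X → ℝ,
      (∀ ε > (0 : ℝ), ∃ σ : G.toStocGame.Strategy1, σ.pure ∧ σ.stateDep ∧
        ∃ N₀ : ℕ, 1 ≤ N₀ ∧
        ∀ x₁, ¬ G.absorbing x₁ → ∀ n ≥ N₀, ∀ τ : G.toStocGame.Strategy2,
          G.toStocGame.avgPayoff x₁ σ τ n ≥ vinf x₁ - ε) ∧
      (∀ ε > (0 : ℝ), ∃ τ : G.toStocGame.Strategy2, τ.pure ∧ τ.stateDep ∧
        ∃ N₀ : ℕ, 1 ≤ N₀ ∧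
        ∀ x₁, ¬ G.absorbing x₁ → ∀ n ≥ N₀, ∀ σ : G.toStocGame.Strategy1,
          G.toStocGame.avgPayoff x₁ σ τ n ≤ vinf x₁ + ε) := by
  have hV : G.HasPureValues G.toStocGame.nValue :=
    ⟨hpure1, fun n hn => (hpure2 n hn).imp fun _ h => h.2⟩
  have hVswap : G.swap.HasPureValues fun n x => - G.toStocGame.nValue n x := by
    constructor
    · intro n hn
      obtain ⟨τ, hτ, hopt⟩ := hpure2 n hn
      refine ⟨τ.toSwap, fun h x => hτ (StocGame.swapHist h) x, fun x σ => ?_⟩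
      have h1 := hopt x σ.ofSwap
      rw [← σ.toSwap_ofSwap, StocGame.avgPayoff_swap]
      exact neg_le_neg h1
    · intro n hn
      obtain ⟨σ, -, hopt⟩ := hpure1 n hn
      refine ⟨σ.toSwap, fun x τ => ?_⟩
      have h1 := hopt x τ.ofSwap
      rw [← τ.toSwap_ofSwap, StocGame.avgPayoff_swap]
      exact neg_le_neg h1
  obtain ⟨v, hv⟩ := exists_isUniformLimsup (fun n hn x => hV.abs_le_one hn x) fun ε hε =>
    (htb ε hε).imp fun _ h => h.2
  have hguar := fun ε (hε : (0 : ℝ) < ε) => hV.uniformly_guarantees hv hε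
  have hvswap : IsUniformLimsup (fun n x => - G.toStocGame.nValue n x) fun x => - v x := by
    refine ⟨fun δ hδ => ?_, fun δ hδ N => ?_⟩
    · obtain ⟨σ, -, -, N₀, hN₀, hσ⟩ := hguar δ hδ
      refine ⟨N₀, fun n hn x => ?_⟩
      obtain ⟨τ, -, hτ⟩ := hpure2 n (hN₀.trans hn)
      linarith [hσ x n hn τ, hτ x σ]
    · obtain ⟨J, hJ⟩ := hv.1 δ hδ
      exact ⟨N + J, fun x => ⟨N + J, by omega, le_rfl, by linarith [hJ (N + J) (by omega) x]⟩⟩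
  refine ⟨v, fun ε hε => ?_, fun ε hε => ?_⟩
  · obtain ⟨σ, hσ1, hσ2, N₀, hN₀, hσ⟩ := hguar ε hε
    exact ⟨σ, hσ1, hσ2, N₀, hN₀, fun x _ => hσ x⟩
  · obtain ⟨σ, hσ1, hσ2, N₀, hN₀, hσ⟩ := hVswap.uniformly_guarantees hvswap hε
    refine ⟨σ.ofSwap, fun h x => hσ1 (StocGame.swapHist h) x, fun h h' x hh => ?_,
      N₀, hN₀, fun x _ n hn τ => ?_⟩
    · refine hσ2 _ _ x ?_
      simpa [StocGame.swapHist, Function.comp_def] using hh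
    · have h1 := hσ x n hn τ.toSwap
      rw [← σ.toSwap_ofSwap] at h1
      have h2 := StocGame.avgPayoff_swap x τ σ.ofSwap n
      linarith
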